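/- Let k ≥ 1 and let C be a Type II ℤ_{2k}-code of length n. Then the Construction A lattice A_{2k}(C) = (1/√(2k))·{x ∈ ℤ^n : (x mod 2k) ∈ C} is an even unimodular lattice in ℝ^n. -/

import Mathlib

open scoped BigOperators

/-- Euclidean weight of a word over `ℤ/mℤ`. -/
def euclWt {m : ℕ} {ι : Type*} [Fintype ι] (x : ι → ZMod m) : ℕ :=
  ∑ i, min ((x i).val ^ 2) ((m - (x i).val) ^ 2)

/-- The dual code under the standard inner product. -/
def dualCode {m : ℕ} {ι : Type*} [Fintype ι]
    (C : Submodule (ZMod m) (ι → ZMod m)) : Set (ι → ZMod m) :=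
  {x | ∀ y ∈ C, ∑ i, x i * y i = 0}

/-- A code is self-dual if it coincides with its dual code. -/
def IsSelfDualCode {m : ℕ} {ι : Type*} [Fintype ι]
    (C : Submodule (ZMod m) (ι → ZMod m)) : Prop :=
  (C : Set (ι → ZMod m)) = dualCode C

/-- A Type II `ℤ_{2k}`-code: self-dual with all Euclidean weights divisible by `4k`. -/
def IsTypeII (k : ℕ) {ι : Type*} [Fintype ι]
    (C : Submodule (ZMod (2 * k)) (ι → ZMod (2 * k))) : Prop :=
  IsSelfDualCode C ∧ ∀ c ∈ C, 4 * k ∣ euclWt c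

/-- The minimum Euclidean weight of a code. -/
noncomputable def minEuclWt {m : ℕ} {ι : Type*} [Fintype ι]
    (C : Submodule (ZMod m) (ι → ZMod m)) : ℕ :=
  sInf {w | ∃ c ∈ C, c ≠ 0 ∧ euclWt c = w}

/-- Standard inner product on `ι → ℝ`. -/
def ip {ι : Type*} [Fintype ι] (x y : ι → ℝ) : ℝ := ∑ i, x i * y i

/-- A lattice: a discrete `ℤ`-submodule of `ℝ^ι` spanning it over `ℝ`. -/
def IsLatticeIn {ι : Type*} [Fintype ι] (L : Submodule ℤ (ι → ℝ)) : Prop :=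
  DiscreteTopology L ∧ Submodule.span ℝ (L : Set (ι → ℝ)) = ⊤

/-- The dual lattice. -/
def dualLattice {ι : Type*} [Fintype ι] (L : Submodule ℤ (ι → ℝ)) : Set (ι → ℝ) :=
  {x | ∀ y ∈ L, ∃ z : ℤ, ip x y = (z : ℝ)}

/-- A lattice is unimodular if it equals its dual. -/
def IsUnimodularLattice {ι : Type*} [Fintype ι] (L : Submodule ℤ (ι → ℝ)) : Prop :=
  (L : Set (ι → ℝ)) = dualLattice L

/-- A lattice is even if every vector has even integral norm. -/
def IsEvenLattice {ι : Type*} [Fintype ι] (L : Submodule ℤ (ι → ℝ)) : Prop :=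
  ∀ x ∈ L, ∃ z : ℤ, ip x x = 2 * (z : ℝ)

/-- `r` is the minimum norm of the lattice `L`. -/
def HasMinNorm {ι : Type*} [Fintype ι] (L : Submodule ℤ (ι → ℝ)) (r : ℝ) : Prop :=
  IsLeast {t : ℝ | ∃ x ∈ L, x ≠ 0 ∧ ip x x = t} r

/-- Construction A: the set `(1/√m)·{x ∈ ℤ^ι : (x mod m) ∈ C}`. -/
def constructionA (m : ℕ) {ι : Type*} [Fintype ι] (C : Set (ι → ZMod m)) :
    Set (ι → ℝ) :=
  {v | ∃ x : ι → ℤ, (fun i => (x i : ZMod m)) ∈ C ∧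
    v = fun i => (x i : ℝ) / Real.sqrt m}

/-- A negacirculant matrix. -/
def IsNegacirculant {m : ℕ} {R : Type*} [CommRing R] (A : Matrix (Fin m) (Fin m) R) : Prop :=
  ∃ r : Fin m → R, ∀ i j : Fin m,
    A i j = if h : (i : ℕ) ≤ (j : ℕ) then r ⟨(j : ℕ) - (i : ℕ), by have := j.isLt; omega⟩
      else - r ⟨m + (j : ℕ) - (i : ℕ), by have := i.isLt; have := j.isLt; omega⟩

/-- Construction A as a `ℤ`-submodule. -/
noncomputable def constructionALattice {m : ℕ} {ι : Type*}
    (C : Submodule (ZMod m) (ι → ZMod m)) : Submodule ℤ (ι → ℝ) where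
  carrier := {v | ∃ x : ι → ℤ, (fun i => (x i : ZMod m)) ∈ C ∧
    v = fun i => (x i : ℝ) / Real.sqrt m}
  zero_mem' := ⟨0, by convert C.zero_mem using 1; ext; simp, by ext; simp⟩
  add_mem' := by
    rintro _ _ ⟨x, hx, rfl⟩ ⟨y, hy, rfl⟩
    refine ⟨x + y, ?_, ?_⟩
    · convert C.add_mem hx hy using 1
      ext i
      simp
    · ext i
      simp [add_div]
  smul_mem' := by
    rintro c _ ⟨x, hx, rfl⟩
    refine ⟨c • x, ?_, ?_⟩
    · convert C.smul_mem (c : ZMod m) hx using 1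
      ext i
      simp
    · ext i
      simp [mul_div_assoc]

theorem mem_constructionALattice {m : ℕ} {ι : Type*}
    {C : Submodule (ZMod m) (ι → ZMod m)} {v : ι → ℝ} :
    v ∈ constructionALattice C ↔ ∃ x : ι → ℤ, (fun i => (x i : ZMod m)) ∈ C ∧
      v = fun i => (x i : ℝ) / Real.sqrt m :=
  Iff.rfl

theorem coe_constructionALattice {m : ℕ} {ι : Type*} [Fintype ι]
    (C : Submodule (ZMod m) (ι → ZMod m)) :
    (constructionALattice C : Set (ι → ℝ)) = constructionA m (C : Set (ι → ZMod m)) :=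
  rfl

theorem single_sqrt_mem_constructionALattice {m : ℕ} {ι : Type*} [DecidableEq ι]
    (C : Submodule (ZMod m) (ι → ZMod m)) (i : ι) :
    Pi.single i (Real.sqrt m) ∈ constructionALattice C := by
  refine ⟨Pi.single i (m : ℤ), ?_, ?_⟩
  · convert C.zero_mem using 1
    ext j
    by_cases h : j = i
    · subst h; simp
    · simp [h]
  · ext j
    by_cases h : j = i
    · subst h; simp
    · simp [h]

theorem isLatticeIn_constructionALattice {m : ℕ} (hm : 0 < m) {ι : Type*} [Fintype ι]
    (C : Submodule (ZMod m) (ι → ZMod m)) : IsLatticeIn (constructionALattice C) := by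
  classical
  have hs : Real.sqrt m ≠ 0 := by positivity
  constructor
  · let b : Module.Basis ι ℝ (ι → ℝ) :=
      (Pi.basisFun ℝ ι).unitsSMul fun _ => (Units.mk0 _ hs)⁻¹
    refine DiscreteTopology.of_subset (s := (Submodule.span ℤ (Set.range b) : Set (ι → ℝ)))
      (inferInstanceAs (DiscreteTopology (Submodule.span ℤ (Set.range b)))) ?_
    rintro _ ⟨x, -, rfl⟩
    have h : (fun i => (x i : ℝ) / Real.sqrt m) = ∑ i, x i • b i := by
      ext j
      simp [b, Module.Basis.unitsSMul_apply, Finset.sum_apply, Pi.single_apply, Units.smul_def,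
        div_eq_mul_inv, mul_comm]
    rw [h]
    exact Submodule.sum_mem _ fun i _ =>
      Submodule.smul_mem _ _ (Submodule.subset_span (Set.mem_range_self i))
  · rw [eq_top_iff]
    intro v _
    have h : v = ∑ i, (v i / Real.sqrt m) • (Pi.single i (Real.sqrt m) : ι → ℝ) := by
      ext j
      simp [Finset.sum_apply, Pi.single_apply, hs]
    rw [h]
    exact Submodule.sum_mem _ fun i _ => Submodule.smul_mem _ _
      (Submodule.subset_span (single_sqrt_mem_constructionALattice C i))

theorem ip_div_sqrt {m : ℕ} {ι : Type*} [Fintype ι] (x y : ι → ℤ) :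
    ip (fun i => (x i : ℝ) / Real.sqrt m) (fun i => (y i : ℝ) / Real.sqrt m) =
      ((∑ i, x i * y i : ℤ) : ℝ) / m := by
  simp [ip, Finset.sum_div, div_mul_div_comm]

theorem isUnimodularLattice_constructionALattice {m : ℕ} (hm : 0 < m) {ι : Type*} [Fintype ι]
    {C : Submodule (ZMod m) (ι → ZMod m)} (hC : IsSelfDualCode C) :
    IsUnimodularLattice (constructionALattice C) := by
  classical
  have hs : Real.sqrt m ≠ 0 := by positivity
  have hm' : (m : ℝ) ≠ 0 := by positivity
  have hC' : ∀ c, c ∈ C ↔ ∀ y ∈ C, ∑ i, c i * y i = 0 := fun c => Set.ext_iff.1 hC c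
  ext v
  constructor
  · rintro ⟨x, hx, rfl⟩ _ ⟨y, hy, rfl⟩
    have h0 := (hC' _).1 hx _ hy
    obtain ⟨z, hz⟩ := (ZMod.intCast_zmod_eq_zero_iff_dvd (∑ i, x i * y i) m).1
      (by push_cast; exact h0)
    refine ⟨z, ?_⟩
    rw [ip_div_sqrt, hz]
    push_cast
    field_simp
  · intro hv
    choose z hz using fun i => hv _ (single_sqrt_mem_constructionALattice C i)
    have hvz : v = fun i => (z i : ℝ) / Real.sqrt m := by
      ext i
      rw [eq_div_iff hs, ← hz i]
      simp [ip, Pi.single_apply]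
    subst hvz
    refine ⟨z, (hC' _).2 fun y hy => ?_, rfl⟩
    obtain ⟨x, rfl⟩ : ∃ x : ι → ℤ, y = fun i => (x i : ZMod m) :=
      ⟨fun i => (y i).cast, by ext i; simp⟩
    obtain ⟨t, ht⟩ := hv _ ⟨x, hy, rfl⟩
    rw [ip_div_sqrt, div_eq_iff hm'] at ht
    have ht' : ∑ i, z i * x i = t * m := by exact_mod_cast ht
    have := congrArg (Int.cast : ℤ → ZMod m) ht'
    simpa using this

theorem sq_modEq_min_sq {k : ℕ} (hk : 0 < k) (x : ℤ) :
    x ^ 2 ≡ (min ((x : ZMod (2 * k)).val ^ 2) ((2 * k - (x : ZMod (2 * k)).val) ^ 2) : ℕ)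
      [ZMOD 4 * k] := by
  have : NeZero (2 * k) := ⟨by omega⟩
  have hlt := ZMod.val_lt (x : ZMod (2 * k))
  have hval : ((x : ZMod (2 * k)).val : ℤ) = x % (2 * k : ℕ) := ZMod.val_intCast x
  obtain ⟨t, ht⟩ : ∃ t : ℤ, x = (x : ZMod (2 * k)).val + 2 * k * t :=
    ⟨x / (2 * k : ℕ), by
      rw [hval]; exact_mod_cast (Int.emod_add_mul_ediv x (2 * k : ℕ)).symm⟩
  generalize (x : ZMod (2 * k)).val = a at hlt ht
  subst ht
  rw [Int.modEq_iff_dvd]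
  rcases min_choice (a ^ 2) ((2 * k - a) ^ 2) with h | h <;> rw [h]
  · exact ⟨-(a * t + k * t ^ 2), by push_cast; ring⟩
  · exact ⟨k - a - a * t - k * t ^ 2, by push_cast [Nat.cast_sub hlt.le]; ring⟩

theorem isEvenLattice_constructionALattice {k : ℕ} (hk : 0 < k) {ι : Type*} [Fintype ι]
    {C : Submodule (ZMod (2 * k)) (ι → ZMod (2 * k))} (hC : ∀ c ∈ C, 4 * k ∣ euclWt c) :
    IsEvenLattice (constructionALattice C) := by
  rintro _ ⟨x, hx, rfl⟩
  have hmod : ∑ i, x i * x i ≡ (euclWt fun i => (x i : ZMod (2 * k)) : ℕ) [ZMOD 4 * k] := by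
    rw [euclWt, Nat.cast_sum]
    refine Int.ModEq.sum fun i _ => ?_
    rw [← sq]
    exact sq_modEq_min_sq hk (x i)
  obtain ⟨z, hz⟩ : (4 * k : ℤ) ∣ ∑ i, x i * x i :=
    (Int.ModEq.dvd_iff hmod).2 (by exact_mod_cast hC _ hx)
  refine ⟨z, ?_⟩
  have hk' : (k : ℝ) ≠ 0 := by positivity
  rw [ip_div_sqrt, hz]
  push_cast
  field_simp
  ring

/-- Construction A applied to a Type II ℤ_{2k}-code gives an even
unimodular lattice. -/
theorem constructionA_typeII_even_unimodular (k n : ℕ) (hk : 1 ≤ k)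
    (C : Submodule (ZMod (2 * k)) (Fin n → ZMod (2 * k))) (hC : IsTypeII k C) :
    ∃ L : Submodule ℤ (Fin n → ℝ),
      (L : Set (Fin n → ℝ)) = constructionA (2 * k) (C : Set (Fin n → ZMod (2 * k))) ∧
      IsLatticeIn L ∧ IsUnimodularLattice L ∧ IsEvenLattice L := by
  exact ⟨constructionALattice C, coe_constructionALattice C,
    isLatticeIn_constructionALattice (by omega) C,
    isUnimodularLattice_constructionALattice (by omega) hC.1,
    isEvenLattice_constructionALattice hk hC.2⟩
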